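/- Let E be a real inner product space, let μ > 0 and α > 1, and let A : E → Set E be monotone and uniformly monotone with parameters μ and α, with 0 ∈ A x⋆. Let (x_k)_{k≥0} be proximal point iterates: x_k - x_{k+1} ∈ A x_{k+1} for every k ≥ 0. Then for every N ≥ 1, the resolvent residual Ã x_N = x_{N-1} - x_N satisfies ‖x_{N-1} - x_N‖² ≤ 2^{(α+3)/(α-1)} · max{ ( (2^{α/(α-1)} - 2)/μ )^{2/(α-1)}, ‖x_0 - x⋆‖² } / N^{(α+1)/(α-1)}. -/

import Mathlib

open scoped RealInnerProductSpace

lemma convexOn_rpow_of_nonpos {q : ℝ} (hq : q ≤ 0) :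
    ConvexOn ℝ (Set.Ioi 0) fun x : ℝ => x ^ q := by
  refine ⟨convex_Ioi 0, fun x hx y hy a b ha hb hab => ?_⟩
  have hxy := convex_Ioi (0 : ℝ) hx hy ha hb hab
  have hlog := strictConcaveOn_log_Ioi.concaveOn.2 hx hy ha hb hab
  simp only [Real.rpow_def_of_pos hxy, Real.rpow_def_of_pos hx, Real.rpow_def_of_pos hy]
  refine (Real.exp_le_exp.2 ?_).trans
    (convexOn_exp.2 (Set.mem_univ (Real.log x * q)) (Set.mem_univ (Real.log y * q)) ha hb hab)
  have h := mul_le_mul_of_nonpos_right hlog hq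
  simp only [smul_eq_mul] at h ⊢
  linarith

/-- Chord bound for the convex function `t ↦ t ^ (-p)` on `[1/2, 1]`. -/
lemma rpow_neg_le_chord {p y : ℝ} (hp : 0 < p) (hy : 1 ≤ y) :
    y ^ (-p) ≤ (y + 1) ^ (-p) * (1 + 2 * (2 ^ p - 1) * (y + 1)⁻¹) := by
  have hy0 : 0 < y := by linarith
  have hy1 : 0 < y + 1 := by linarith
  have hconv : ConvexOn ℝ (Set.Ioi 0) fun x : ℝ => x ^ (-p) :=
    convexOn_rpow_of_nonpos (by linarith)
  have hw : 0 ≤ 1 - 2 * (y + 1)⁻¹ := by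
    have : (y + 1)⁻¹ ≤ 2⁻¹ := inv_anti₀ (by norm_num) (by linarith)
    linarith
  have h := hconv.2 (Set.mem_Ioi.2 one_pos) (Set.mem_Ioi.2 (by norm_num : (0 : ℝ) < 2⁻¹)) hw
    (by positivity : 0 ≤ 2 * (y + 1)⁻¹) (by ring)
  have hpt : (1 - 2 * (y + 1)⁻¹) • (1 : ℝ) + (2 * (y + 1)⁻¹) • (2⁻¹ : ℝ) = y / (y + 1) := by
    simp only [smul_eq_mul]
    field_simp
    ring
  have h2 : (2⁻¹ : ℝ) ^ (-p) = 2 ^ p := by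
    rw [Real.inv_rpow (by norm_num), Real.rpow_neg (by norm_num), inv_inv]
  beta_reduce at h
  rw [hpt, Real.one_rpow, h2, smul_eq_mul, smul_eq_mul] at h
  rw [Real.div_rpow hy0.le hy1.le, div_le_iff₀ (Real.rpow_pos_of_pos hy1 _)] at h
  linarith

/-- One step of the recursion `b + μ b ^ α ≤ a` preserves the rate `y ^ (-1 / (α - 1))`. -/
lemma le_mul_rpow_of_add_mul_rpow_le {μ α a b C y : ℝ} (hμ : 0 < μ) (hα : 1 < α)
    (hC : 0 < C) (hCμ : 2 * (2 ^ (1 / (α - 1)) - 1) ≤ μ * C ^ (α - 1)) (hy : 1 ≤ y)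
    (hab : b + μ * b ^ α ≤ a) (ha : a ≤ C * y ^ (-(1 / (α - 1)))) :
    b ≤ C * (y + 1) ^ (-(1 / (α - 1))) := by
  have hα1 : 0 < α - 1 := by linarith
  have hy1 : 0 < y + 1 := by linarith
  by_contra! hlt
  set p := 1 / (α - 1) with hp
  set z := (y + 1) ^ (-p) with hz
  have hzpos : 0 < z := Real.rpow_pos_of_pos hy1 _
  have hchord : y ^ (-p) ≤ z * (1 + 2 * (2 ^ p - 1) * (y + 1)⁻¹) :=
    rpow_neg_le_chord (by positivity) hy
  have hzα : z ^ α = z * (y + 1)⁻¹ := by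
    rw [hz, ← Real.rpow_mul hy1.le, ← Real.rpow_neg_one (y + 1), ← Real.rpow_add hy1]
    congr 1
    rw [hp]
    field_simp
    ring
  have hCα : C ^ α = C * C ^ (α - 1) := by
    rw [Real.rpow_sub_one hC.ne']
    field_simp
  have hpow : (C * z) ^ α ≤ b ^ α := Real.rpow_le_rpow (by positivity) hlt.le (by linarith)
  rw [Real.mul_rpow hC.le hzpos.le, hzα, hCα] at hpow
  have h1 := mul_le_mul_of_nonneg_left hpow hμ.le
  have h2 := mul_le_mul_of_nonneg_left hCμ (by positivity : 0 ≤ C * z * (y + 1)⁻¹)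
  have h3 := mul_le_mul_of_nonneg_left hchord hC.le
  linarith

section ProximalPoint

variable {E : Type*} [NormedAddCommGroup E] [InnerProductSpace ℝ E]

lemma norm_add_mul_rpow_le_of_inner {μ α : ℝ} (hα : 1 < α) {v w : E}
    (h : ⟪v - w, w⟫ ≥ μ * ‖w‖ ^ (α + 1)) : ‖w‖ + μ * ‖w‖ ^ α ≤ ‖v‖ := by
  rcases (norm_nonneg w).eq_or_lt with h0 | h0
  · rw [← h0, Real.zero_rpow (by linarith)]
    simp
  · have hcs := real_inner_le_norm v w
    rw [inner_sub_left, real_inner_self_eq_norm_sq, Real.rpow_add_one h0.ne'] at h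
    refine le_of_mul_le_mul_right ?_ h0
    nlinarith

lemma norm_sq_add_norm_sub_sq_le {v w : E} (h : 0 ≤ ⟪v - w, w⟫) :
    ‖w‖ ^ 2 + ‖v - w‖ ^ 2 ≤ ‖v‖ ^ 2 := by
  have := norm_add_sq_real (v - w) w
  rw [sub_add_cancel] at this
  linarith

lemma norm_le_norm_of_inner_sub_nonneg {u v : E} (h : 0 ≤ ⟪u - v, v⟫) : ‖v‖ ≤ ‖u‖ := by
  have := norm_sq_add_norm_sub_sq_le h
  exact le_of_sq_le_sq (by nlinarith [sq_nonneg ‖u - v‖]) (norm_nonneg _)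

end ProximalPoint

/-- A nonincreasing `r` with `d (k + 1) + r k ≤ d k` is at most `d k` over the elapsed time. -/
lemma Antitone.mul_le_of_add_le {r d : ℕ → ℝ} (hr : Antitone r) (hd : ∀ k, 0 ≤ d k)
    (h : ∀ k, d (k + 1) + r k ≤ d k) (k m : ℕ) : ((m : ℝ) + 1) * r (k + m) ≤ d k := by
  have key : ∀ j ≤ m + 1, d (k + j) + (j : ℝ) * r (k + m) ≤ d k := by
    intro j
    induction j with
    | zero => simp
    | succ j ih =>
      intro hj
      have h1 := ih (by omega)
      have h2 := h (k + j)
      have h3 : r (k + m) ≤ r (k + j) := hr (by omega)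
      push_cast
      rw [← add_assoc k j 1]
      linarith
  have h1 := key (m + 1) le_rfl
  have h2 := hd (k + (m + 1))
  push_cast at h1
  linarith

/-- For a uniformly monotone operator `A` (parameters `μ > 0`, `α > 1`)
with zero `x⋆` and proximal point iterates `x_{k+1} = J_A x_k`, the resolvent residual
`Ã x_N = x_{N-1} - x_N` satisfies
`‖x_{N-1} - x_N‖² ≤ 2^{(α+3)/(α-1)} max{((2^{α/(α-1)}-2)/μ)^{2/(α-1)}, ‖x₀-x⋆‖²} / N^{(α+1)/(α-1)}`
for every `N ≥ 1`. -/
theorem ppm_residual_rate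
    {E : Type*} [NormedAddCommGroup E] [InnerProductSpace ℝ E]
    (μ α : ℝ) (hμ : 0 < μ) (hα : 1 < α)
    (A : E → Set E)
    (hmono : ∀ x y u v : E, u ∈ A x → v ∈ A y → 0 ≤ ⟪u - v, x - y⟫)
    (xstar : E) (hzero : (0 : E) ∈ A xstar)
    (hunif : ∀ (x u : E), u ∈ A x → ⟪u, x - xstar⟫ ≥ μ * ‖x - xstar‖ ^ (α + 1))
    (x : ℕ → E) (hppm : ∀ k : ℕ, x k - x (k + 1) ∈ A (x (k + 1))) :
    ∀ N : ℕ, 1 ≤ N →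
      ‖x (N - 1) - x N‖ ^ 2 ≤
        (2 : ℝ) ^ ((α + 3) / (α - 1)) *
          max ((((2 : ℝ) ^ (α / (α - 1)) - 2) / μ) ^ (2 / (α - 1))) (‖x 0 - xstar‖ ^ 2) /
          (N : ℝ) ^ ((α + 1) / (α - 1)) := by
  intro N hN
  have hα1 : 0 < α - 1 := by linarith
  set p := 1 / (α - 1) with hp
  have hp0 : 0 < p := by positivity
  have e1 : α / (α - 1) = 1 + p := by rw [hp]; field_simp; ring
  have e2 : 2 / (α - 1) = p * 2 := by rw [hp]; ring
  have e3 : (α + 3) / (α - 1) = 1 + 4 * p := by rw [hp]; field_simp; ring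
  have e4 : (α + 1) / (α - 1) = 1 + 2 * p := by rw [hp]; field_simp; ring
  rw [e1, e2, e3, e4, Real.rpow_add two_pos 1 p, Real.rpow_one]
  have h2p : (1 : ℝ) < 2 ^ p := Real.one_lt_rpow one_lt_two hp0
  set B : ℝ := (2 * 2 ^ p - 2) / μ with hB
  have hB0 : 0 < B := div_pos (by linarith) hμ
  set C : ℝ := max (B ^ p) ‖x 0 - xstar‖ with hC
  have hBC : B ^ p ≤ C := le_max_left _ _
  have hC0 : 0 < C := (Real.rpow_pos_of_pos hB0 p).trans_le hBC
  have hCsq : C ^ 2 ≤ max (B ^ (p * 2)) (‖x 0 - xstar‖ ^ 2) := by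
    rw [Real.rpow_mul hB0.le, Real.rpow_two]
    rcases max_choice (B ^ p) ‖x 0 - xstar‖ with h | h
    · rw [hC, h]; exact le_max_left _ _
    · rw [hC, h]; exact le_max_right _ _
  have hCμ : 2 * (2 ^ p - 1) ≤ μ * C ^ (α - 1) := by
    have h := Real.rpow_le_rpow (by positivity) hBC hα1.le
    rw [← Real.rpow_mul hB0.le, hp, one_div_mul_cancel hα1.ne', Real.rpow_one, hB, div_le_iff₀ hμ] at h
    linarith
  have hinner : ∀ k, ⟪(x k - xstar) - (x (k + 1) - xstar), x (k + 1) - xstar⟫ ≥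
      μ * ‖x (k + 1) - xstar‖ ^ (α + 1) := fun k => by
    rw [sub_sub_sub_cancel_right]
    exact hunif _ _ (hppm k)
  have hdist : ∀ k : ℕ, ‖x k - xstar‖ ≤ C * ((k : ℝ) + 1) ^ (-p) := by
    intro k
    induction k with
    | zero => simp [hC]
    | succ k ih =>
      push_cast
      exact le_mul_rpow_of_add_mul_rpow_le hμ hα hC0 hCμ
        (by linarith [Nat.cast_nonneg (α := ℝ) k])
        (norm_add_mul_rpow_le_of_inner hα (hinner k)) ih
  have hanti : Antitone fun k => ‖x k - x (k + 1)‖ ^ 2 := by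
    refine antitone_nat_of_succ_le fun k => ?_
    exact pow_le_pow_left₀ (norm_nonneg _)
      (norm_le_norm_of_inner_sub_nonneg (hmono _ _ _ _ (hppm k) (hppm (k + 1)))) 2
  have hdesc : ∀ k, ‖x (k + 1) - xstar‖ ^ 2 + ‖x k - x (k + 1)‖ ^ 2 ≤ ‖x k - xstar‖ ^ 2 := by
    intro k
    have h := norm_sq_add_norm_sub_sq_le
      ((by positivity : 0 ≤ μ * ‖x (k + 1) - xstar‖ ^ (α + 1)).trans (hinner k))
    rwa [sub_sub_sub_cancel_right] at h
  obtain ⟨n, rfl⟩ : ∃ n, N = n + 1 := ⟨N - 1, by omega⟩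
  obtain ⟨k, m, rfl, hk, hm⟩ : ∃ k m, n = k + m ∧ n + 1 ≤ 2 * (k + 1) ∧ n + 1 ≤ 2 * (m + 1) :=
    ⟨n / 2, n - n / 2, by omega, by omega, by omega⟩
  rw [Nat.add_sub_cancel]
  have hsum := hanti.mul_le_of_add_le (d := fun k => ‖x k - xstar‖ ^ 2)
    (fun k => sq_nonneg _) hdesc k m
  set R := ‖x (k + m) - x (k + m + 1)‖ ^ 2
  set M := max (B ^ (p * 2)) (‖x 0 - xstar‖ ^ 2)
  set L : ℝ := ((k + m + 1 : ℕ) : ℝ) with hL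
  have hL0 : 0 < L := by positivity
  have hkL : L / 2 ≤ (k : ℝ) + 1 := by
    have : L ≤ 2 * ((k : ℝ) + 1) := by rw [hL]; exact_mod_cast hk
    linarith
  have hmL : L / 2 ≤ (m : ℝ) + 1 := by
    have : L ≤ 2 * ((m : ℝ) + 1) := by rw [hL]; exact_mod_cast hm
    linarith
  have hL2 : 0 < L / 2 := by positivity
  have hbound : L / 2 * R ≤ M * (L / 2) ^ (-(2 * p)) := calc
    L / 2 * R ≤ ((m : ℝ) + 1) * R := by gcongr
    _ ≤ ‖x k - xstar‖ ^ 2 := hsum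
    _ ≤ (C * (L / 2) ^ (-p)) ^ 2 := by
      refine pow_le_pow_left₀ (norm_nonneg _) ((hdist k).trans ?_) 2
      exact mul_le_mul_of_nonneg_left
        (Real.rpow_le_rpow_of_nonpos hL2 hkL (by linarith)) hC0.le
    _ = C ^ 2 * (L / 2) ^ (-(2 * p)) := by
      rw [mul_pow, ← Real.rpow_mul_natCast hL2.le]
      congr 2
      push_cast
      ring
    _ ≤ M * (L / 2) ^ (-(2 * p)) := by gcongr
  have hM0 : 0 ≤ M := (sq_nonneg C).trans hCsq
  have hpow : (L / 2) ^ (1 + 2 * p) * R ≤ M := by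
    rw [Real.rpow_neg hL2.le, ← div_eq_mul_inv, le_div_iff₀ (by positivity)] at hbound
    rw [Real.rpow_add hL2, Real.rpow_one]
    linarith
  rw [Real.div_rpow hL0.le two_pos.le, div_mul_eq_mul_div, div_le_iff₀ (by positivity)] at hpow
  rw [le_div_iff₀ (by positivity)]
  have hexp : (2 : ℝ) ^ (1 + 2 * p) ≤ 2 ^ (1 + 4 * p) :=
    Real.rpow_le_rpow_of_exponent_le one_le_two (by linarith)
  have := mul_le_mul_of_nonneg_left hexp hM0
  linarith
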